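/- arXiv:2008.00721 — 2 statements merged into one kernel-verified Lean document; each statement's English description precedes it below -/
import Mathlib

section
/- For every $d\ge 0$ and every $I=(I_1,\dots,I_d)\in\mathcal{I}_d$ one has, in $A$, $\omega_{I}=\frac{1}{d!}\sum_{\sigma\in S_d}\mathrm{sgn}(\sigma)\,d_{I_{\sigma(1)}}\cdots d_{I_{\sigma(d)}}$, where $S_d$ is the symmetric group on $\{1,\dots,d\}$. -/
open scoped Classical

noncomputable section
/-- The complementary index `t_{ijkl}`: the unique element of `Fin 5` not among
distinct `i,j,k,l` (garbage value otherwise, where `eps` vanishes anyway). -/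
def tIdx (i j k l : Fin 5) : Fin 5 :=
  ⟨(10 - (i.val + j.val + k.val + l.val)) % 5, Nat.mod_lt _ (by norm_num)⟩

/-- The sign `ε_{ijkl}`: the sign of the permutation `(i,j,k,l,t_{ijkl})` of `Fin 5`
if `i,j,k,l` are pairwise distinct, and `0` otherwise (Levi-Civita formula). -/
def eps (i j k l : Fin 5) : ℤ :=
  ∏ q : Fin 5, ∏ p ∈ Finset.univ.filter (fun p => p < q),
    Int.sign ((![(i.val : ℤ), (j.val : ℤ), (k.val : ℤ), (l.val : ℤ), ((tIdx i j k l).val : ℤ)]) q -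
      (![(i.val : ℤ), (j.val : ℤ), (k.val : ℤ), (l.val : ℤ), ((tIdx i j k l).val : ℤ)]) p)

/-- A unital associative `ℂ`-algebra `A` together with elements `d i j` and `∂ t`
satisfying the defining relations of `U_- = U(g_{-1} ⊕ g_{-2})` for `E(5,10)`. -/
structure E510Rep (A : Type*) [Ring A] [Algebra ℂ A] where
  d : Fin 5 → Fin 5 → A
  p : Fin 5 → A
  d_antisymm : ∀ i j, d i j = - d j i
  pd_comm : ∀ t i j, p t * d i j = d i j * p t
  pp_comm : ∀ s t, p s * p t = p t * p s
  dd_rel : ∀ i j k l, d i j * d k l + d k l * d i j = eps i j k l • p (tIdx i j k l)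

/-- Self-intersection free families of position pairs (each pair recorded as an
ordered pair `(k,l)` with `k < l`; the pairs are pairwise disjoint). -/
def isSIF {n : ℕ} (S : Finset (Fin n × Fin n)) : Prop :=
  (∀ q ∈ S, q.1 < q.2) ∧
    ∀ q ∈ S, ∀ q' ∈ S, q ≠ q' → q.1 ≠ q'.1 ∧ q.1 ≠ q'.2 ∧ q.2 ≠ q'.1 ∧ q.2 ≠ q'.2

/-- Two disjoint pairs cross if exactly one member of one lies strictly between
the members of the other. -/
def crosses {n : ℕ} (q q' : Fin n × Fin n) : Prop :=
  (q.1 < q'.1 ∧ q'.1 < q.2 ∧ q.2 < q'.2) ∨ (q'.1 < q.1 ∧ q.1 < q'.2 ∧ q'.2 < q.2)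

/-- The crossing number `c(S)`: the number of (unordered) pairs of elements of `S`
that cross (each counted once, using the order of first components). -/
def crossNum {n : ℕ} (S : Finset (Fin n × Fin n)) : ℕ :=
  ((S ×ˢ S).filter (fun z => z.1.1 < z.2.1 ∧ crosses z.1 z.2)).card

/-- The scalar part of `D_S(I)`: the product over `{k,l} ∈ S` of `(1/2)(-1)^{k+l} ε_{I_k,I_l}`. -/
def DScalar {n : ℕ} (I : Fin n → Fin 5 × Fin 5) (S : Finset (Fin n × Fin n)) : ℂ :=
  ∏ q ∈ S, ((-1 : ℂ) ^ (q.1.val + q.2.val) *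
    ((eps (I q.1).1 (I q.1).2 (I q.2).1 (I q.2).2 : ℤ) : ℂ) / 2)

/-- The multiplicity of `∂ t` in `D_S(I)`. -/
def pCount {n : ℕ} (I : Fin n → Fin 5 × Fin 5) (S : Finset (Fin n × Fin n)) (t : Fin 5) : ℕ :=
  (S.filter (fun q => tIdx (I q.1).1 (I q.1).2 (I q.2).1 (I q.2).2 = t)).card

section Alg

variable {A : Type*} [Ring A] [Algebra ℂ A]

/-- The monomial `∂^M = ∂_1^{m_1} ⋯ ∂_5^{m_5}`. -/
def pMono (pp : Fin 5 → A) (c : Fin 5 → ℕ) : A :=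
  pp 0 ^ c 0 * pp 1 ^ c 1 * pp 2 ^ c 2 * pp 3 ^ c 3 * pp 4 ^ c 4

/-- `d_{C_S(I)}`: the ordered product of the `d`'s over the positions of `I`
not covered by `S`. -/
def dRest (dd : Fin 5 → Fin 5 → A) {n : ℕ} (I : Fin n → Fin 5 × Fin 5)
    (S : Finset (Fin n × Fin n)) : A :=
  (((Finset.univ.filter (fun i : Fin n => ∀ q ∈ S, i ≠ q.1 ∧ i ≠ q.2)).sort (· ≤ ·)).map
    (fun i => dd (I i).1 (I i).2)).prod

/-- The summand `(-1)^{c(S)} D_S(I) d_{C_S(I)}` of `ω_I` (here `D_S(I)` is written as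
its scalar part times the corresponding `∂`-monomial, to which it is equal since
the `∂`'s commute). -/
def omegaBody (dd : Fin 5 → Fin 5 → A) (pp : Fin 5 → A) {n : ℕ}
    (I : Fin n → Fin 5 × Fin 5) (S : Finset (Fin n × Fin n)) : A :=
  ((-1 : ℂ) ^ crossNum S * DScalar I S) • (pMono pp (pCount I S) * dRest dd I S)

/-- `ω_I = ∑_{S SIF} (-1)^{c(S)} D_S(I) d_{C_S(I)}`. -/
def omegaOf (dd : Fin 5 → Fin 5 → A) (pp : Fin 5 → A) {n : ℕ} (I : Fin n → Fin 5 × Fin 5) : A :=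
  ∑ S : Finset (Fin n × Fin n), if isSIF S then omegaBody dd pp I S else 0

end Alg

theorem tIdx_swap (i j k l : Fin 5) : tIdx k l i j = tIdx i j k l := by
  simp only [tIdx, Fin.mk.injEq]
  congr 2
  ring

theorem eps_swap : ∀ i j k l : Fin 5, eps k l i j = eps i j k l := by
  set_option maxRecDepth 100000 in decide

section Swap

variable {n : ℕ} {a b : Fin n}

/-- The family of position pairs obtained from `S` by swapping the positions `a` and `b`. -/
def swapPairs (a b : Fin n) (S : Finset (Fin n × Fin n)) : Finset (Fin n × Fin n) :=
  S.map (Equiv.prodCongr (Equiv.swap a b) (Equiv.swap a b)).toEmbedding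

/-- The positions not covered by `S`. -/
def uncovered (S : Finset (Fin n × Fin n)) : Finset (Fin n) :=
  Finset.univ.filter (fun i : Fin n => ∀ q ∈ S, i ≠ q.1 ∧ i ≠ q.2)

theorem mem_uncovered {S : Finset (Fin n × Fin n)} {i : Fin n} :
    i ∈ uncovered S ↔ ∀ q ∈ S, i ≠ q.1 ∧ i ≠ q.2 := by
  simp [uncovered]

theorem swapPairs_swapPairs (S : Finset (Fin n × Fin n)) :
    swapPairs a b (swapPairs a b S) = S := by
  ext ⟨x, y⟩
  simp [swapPairs]

theorem mem_swapPairs {S : Finset (Fin n × Fin n)} {q : Fin n × Fin n} :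
    q ∈ swapPairs a b S ↔ (Equiv.swap a b q.1, Equiv.swap a b q.2) ∈ S := by
  constructor
  · intro h
    simp only [swapPairs, Finset.mem_map] at h
    obtain ⟨r, hr, rfl⟩ := h
    simpa using hr
  · intro h
    simp only [swapPairs, Finset.mem_map]
    exact ⟨_, h, by simp⟩

theorem mem_uncovered_swapPairs {S : Finset (Fin n × Fin n)} {i : Fin n} :
    i ∈ uncovered (swapPairs a b S) ↔ Equiv.swap a b i ∈ uncovered S := by
  simp only [mem_uncovered]
  constructor
  · intro h q hq
    have := h (Equiv.swap a b q.1, Equiv.swap a b q.2) (mem_swapPairs.2 (by simpa using hq))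
    constructor
    · rintro h1
      apply this.1
      rw [← h1, Equiv.swap_apply_self]
    · rintro h1
      apply this.2
      rw [← h1, Equiv.swap_apply_self]
  · intro h q hq
    have := h _ (mem_swapPairs.1 hq)
    simpa using this

theorem swap_val_of_succ (k : Fin n) :
    (Equiv.swap a b k).val = if k.val = a.val then b.val else if k.val = b.val then a.val
      else k.val := by
  simp only [Equiv.swap_apply_def, Fin.ext_iff]
  split_ifs <;> rfl

/-- Self-intersection free families which do not contain `(a, b)` but cover `a` or `b`. -/
def IsMixed (a b : Fin n) (S : Finset (Fin n × Fin n)) : Prop :=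
  isSIF S ∧ (a, b) ∉ S ∧ ¬ (a ∈ uncovered S ∧ b ∈ uncovered S)

theorem isSIF.swapPairs (hab : b.val = a.val + 1) {S : Finset (Fin n × Fin n)} (hS : isSIF S)
    (h : (a, b) ∉ S) : isSIF (swapPairs a b S) := by
  refine ⟨fun q hq => ?_, fun q hq q' hq' hne => ?_⟩
  · have h1 := hS.1 _ (mem_swapPairs.1 hq)
    have h2 : ¬ (Equiv.swap a b q.1 = a ∧ Equiv.swap a b q.2 = b) := by
      rintro ⟨h3, h4⟩
      have := mem_swapPairs.1 hq
      rw [h3, h4] at this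
      exact h this
    simp only [Fin.lt_def, Fin.ext_iff, swap_val_of_succ] at *
    grind
  · have := hS.2 _ (mem_swapPairs.1 hq) _ (mem_swapPairs.1 hq') (by
      intro h
      apply hne
      simp only [Prod.mk.injEq, EmbeddingLike.apply_eq_iff_eq] at h
      exact Prod.ext h.1 h.2)
    simpa using this

theorem IsMixed.swapPairs (hab : b.val = a.val + 1) {S : Finset (Fin n × Fin n)}
    (hS : IsMixed a b S) : IsMixed a b (swapPairs a b S) := by
  refine ⟨hS.1.swapPairs hab hS.2.1, ?_, ?_⟩
  · rw [mem_swapPairs]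
    simp only [Equiv.swap_apply_left, Equiv.swap_apply_right]
    intro h
    have := hS.1.1 _ h
    simp only [Fin.lt_def] at this
    omega
  · simp only [mem_uncovered_swapPairs, Equiv.swap_apply_left, Equiv.swap_apply_right]
    exact fun h => hS.2.2 h.symm

theorem dRest_swapPairs {A : Type*} [Ring A] (hab : b.val = a.val + 1)
    (dd : Fin 5 → Fin 5 → A) (I : Fin n → Fin 5 × Fin 5) {S : Finset (Fin n × Fin n)}
    (hS : IsMixed a b S) :
    dRest dd (I ∘ Equiv.swap a b) (swapPairs a b S) = dRest dd I S := by
  have h1 : uncovered (swapPairs a b S)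
      = (uncovered S).map (Equiv.swap a b).toEmbedding := by
    ext i
    rw [mem_uncovered_swapPairs, Finset.mem_map_equiv, Equiv.symm_swap]
  have h2 : StrictMonoOn (Equiv.swap a b) (uncovered S : Set (Fin n)) := by
    intro x hx y hy hxy
    have h3 : ¬ (x = a ∧ y = b) := by
      rintro ⟨rfl, rfl⟩
      exact hS.2.2 ⟨hx, hy⟩
    simp only [Fin.lt_def, Fin.ext_iff, swap_val_of_succ] at *
    grind
  change ((((uncovered (swapPairs a b S)).sort (· ≤ ·)).map _).prod) =
    (((uncovered S).sort (· ≤ ·)).map _).prod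
  rw [h1]
  have h3 := StrictMonoOn.map_finsetSort (s := uncovered S)
    (f := (Equiv.swap a b).toEmbedding) h2
  rw [← h3, List.map_map]
  congr 2
  funext i
  simp

theorem pCount_swapPairs (I : Fin n → Fin 5 × Fin 5) (S : Finset (Fin n × Fin n)) :
    pCount (I ∘ Equiv.swap a b) (swapPairs a b S) = pCount I S := by
  funext t
  simp only [pCount, swapPairs, Finset.filter_map, Finset.card_map]
  congr 2
  funext q
  simp

theorem DScalar_swapPairs_mul (I : Fin n → Fin 5 × Fin 5) (S : Finset (Fin n × Fin n)) :
    DScalar (I ∘ Equiv.swap a b) (swapPairs a b S) =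
      (∏ q ∈ S, (-1 : ℂ) ^ (q.1.val + q.2.val + (Equiv.swap a b q.1).val
        + (Equiv.swap a b q.2).val)) * DScalar I S := by
  simp only [DScalar, swapPairs, Finset.prod_map, ← Finset.prod_mul_distrib]
  refine Finset.prod_congr rfl fun q _ => ?_
  simp only [Equiv.coe_toEmbedding, Equiv.prodCongr_apply, Prod.map, Function.comp,
    Equiv.swap_apply_self]
  have : (-1 : ℂ) ^ (q.1.val + q.2.val) * (-1 : ℂ) ^ (q.1.val + q.2.val) = 1 := by
    rw [← mul_pow]; simp
  rw [add_assoc (q.1.val + q.2.val), pow_add (-1 : ℂ) (q.1.val + q.2.val)]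
  linear_combination (-1 : ℂ) ^ ((Equiv.swap a b q.1).val + (Equiv.swap a b q.2).val) *
    (eps (I q.1).1 (I q.1).2 (I q.2).1 (I q.2).2 : ℂ) / 2 * (-this)

/-- The factor `-1` for `q` starting first and crossing `q'`, and `1` otherwise. -/
def crossFactor (q q' : Fin n × Fin n) : ℂ :=
  if q.1 < q'.1 ∧ q'.1 < q.2 ∧ q.2 < q'.2 then -1 else 1

theorem neg_one_pow_crossNum (S : Finset (Fin n × Fin n)) :
    (-1 : ℂ) ^ crossNum S = ∏ z ∈ S ×ˢ S, crossFactor z.1 z.2 := by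
  simp only [crossNum, crossFactor, Finset.prod_ite, Finset.prod_const_one, mul_one,
    Finset.prod_const]
  congr 2
  ext z
  rw [Finset.mem_filter, Finset.mem_filter]
  unfold crosses
  constructor
  · rintro ⟨h1, h2, h3 | h3⟩
    · exact ⟨h1, h3⟩
    · exact absurd h2 (lt_asymm h3.1)
  · rintro ⟨h1, h2⟩
    exact ⟨h1, h2.1, Or.inl h2⟩

theorem crossFactor_mul_self (q q' : Fin n × Fin n) :
    crossFactor q q' * crossFactor q q' = 1 := by
  unfold crossFactor; split_ifs <;> simp

theorem neg_one_pow_crossNum_swapPairs (S : Finset (Fin n × Fin n)) :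
    (-1 : ℂ) ^ crossNum (swapPairs a b S) = (∏ z ∈ S ×ˢ S,
      crossFactor (z.1.map (Equiv.swap a b) (Equiv.swap a b))
        (z.2.map (Equiv.swap a b) (Equiv.swap a b)) * crossFactor z.1 z.2)
      * (-1 : ℂ) ^ crossNum S := by
  rw [neg_one_pow_crossNum, neg_one_pow_crossNum, ← Finset.prod_mul_distrib,
    Finset.prod_product, Finset.prod_product, swapPairs, Finset.prod_map]
  refine Finset.prod_congr rfl fun q _ => ?_
  rw [Finset.prod_map]
  refine Finset.prod_congr rfl fun q' _ => ?_
  rw [mul_assoc, crossFactor_mul_self, mul_one]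
  rfl

theorem parityFactor_of_not_mem {q : Fin n × Fin n} (ha : a ≠ q.1 ∧ a ≠ q.2)
    (hb : b ≠ q.1 ∧ b ≠ q.2) :
    (-1 : ℂ) ^ (q.1.val + q.2.val + (Equiv.swap a b q.1).val + (Equiv.swap a b q.2).val) = 1 := by
  rw [Equiv.swap_apply_of_ne_of_ne ha.1.symm hb.1.symm,
    Equiv.swap_apply_of_ne_of_ne ha.2.symm hb.2.symm]
  exact Even.neg_one_pow ⟨q.1.val + q.2.val, by ring⟩

theorem parityFactor_of_mem (hab : b.val = a.val + 1) {q : Fin n × Fin n} (hq : q.1 < q.2)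
    (hne : q ≠ (a, b)) (h : (a = q.1 ∨ a = q.2) ∨ (b = q.1 ∨ b = q.2)) :
    (-1 : ℂ) ^ (q.1.val + q.2.val + (Equiv.swap a b q.1).val + (Equiv.swap a b q.2).val)
      = -1 := by
  apply Odd.neg_one_pow
  obtain ⟨x, y⟩ := q
  simp only [ne_eq, Prod.mk.injEq, Fin.lt_def, Fin.ext_iff, swap_val_of_succ] at *
  rw [Nat.odd_iff]
  split_ifs <;> omega

theorem crossFactor_swap_of_not_mem (hab : b.val = a.val + 1) {q q' : Fin n × Fin n}
    (h : ¬ ((a = q.1 ∨ a = q.2) ∧ (b = q'.1 ∨ b = q'.2)))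
    (h' : ¬ ((a = q'.1 ∨ a = q'.2) ∧ (b = q.1 ∨ b = q.2))) :
    crossFactor (q.map (Equiv.swap a b) (Equiv.swap a b))
      (q'.map (Equiv.swap a b) (Equiv.swap a b)) * crossFactor q q' = 1 := by
  have : crossFactor (q.map (Equiv.swap a b) (Equiv.swap a b))
      (q'.map (Equiv.swap a b) (Equiv.swap a b)) = crossFactor q q' := by
    unfold crossFactor
    refine if_congr ?_ rfl rfl
    obtain ⟨x, y⟩ := q
    obtain ⟨z, w⟩ := q'
    simp only [Prod.map, Fin.lt_def, Fin.ext_iff, swap_val_of_succ] at *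
    split_ifs <;> omega
  rw [this, crossFactor_mul_self]

theorem crossFactor_swap_of_mem (hab : b.val = a.val + 1) {q q' : Fin n × Fin n}
    (hq : q.1 < q.2) (hq' : q'.1 < q'.2)
    (hd : q.1 ≠ q'.1 ∧ q.1 ≠ q'.2 ∧ q.2 ≠ q'.1 ∧ q.2 ≠ q'.2)
    (ha : a = q.1 ∨ a = q.2) (hb : b = q'.1 ∨ b = q'.2) :
    (crossFactor (q.map (Equiv.swap a b) (Equiv.swap a b))
      (q'.map (Equiv.swap a b) (Equiv.swap a b)) * crossFactor q q') *
    (crossFactor (q'.map (Equiv.swap a b) (Equiv.swap a b))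
      (q.map (Equiv.swap a b) (Equiv.swap a b)) * crossFactor q' q) = -1 := by
  obtain ⟨x, y⟩ := q
  obtain ⟨z, w⟩ := q'
  have hx := swap_val_of_succ (a := a) (b := b) x
  have hy := swap_val_of_succ (a := a) (b := b) y
  have hz := swap_val_of_succ (a := a) (b := b) z
  have hw := swap_val_of_succ (a := a) (b := b) w
  simp only [crossFactor, Prod.map, Fin.lt_def, Fin.ext_iff, ne_eq] at *
  generalize (Equiv.swap a b x).val = x' at *
  generalize (Equiv.swap a b y).val = y' at *
  generalize (Equiv.swap a b z).val = z' at *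
  generalize (Equiv.swap a b w).val = w' at *
  generalize x.val = x at *
  generalize y.val = y at *
  generalize z.val = z at *
  generalize w.val = w at *
  rw [hab] at *
  generalize a.val = a at *
  rcases ha with rfl | rfl <;> rcases hb with rfl | rfl
  · rw [if_pos rfl] at hx
    rw [if_neg (by omega), if_neg (by omega)] at hy
    rw [if_neg (by omega), if_pos rfl] at hz
    rw [if_neg (by omega), if_neg (by omega)] at hw
    subst hx hy hz hw
    split_ifs <;> first | omega | norm_num
  · rw [if_pos rfl] at hx
    rw [if_neg (by omega), if_neg (by omega)] at hy
    rw [if_neg (by omega), if_neg (by omega)] at hz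
    rw [if_neg (by omega), if_pos rfl] at hw
    subst hx hy hz hw
    split_ifs <;> first | omega | norm_num
  · rw [if_neg (by omega), if_neg (by omega)] at hx
    rw [if_pos rfl] at hy
    rw [if_neg (by omega), if_pos rfl] at hz
    rw [if_neg (by omega), if_neg (by omega)] at hw
    subst hx hy hz hw
    split_ifs <;> first | omega | norm_num
  · rw [if_neg (by omega), if_neg (by omega)] at hx
    rw [if_pos rfl] at hy
    rw [if_neg (by omega), if_neg (by omega)] at hz
    rw [if_neg (by omega), if_pos rfl] at hw
    subst hx hy hz hw
    split_ifs <;> first | omega | norm_num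

theorem sign_swapPairs (hab : b.val = a.val + 1) (I : Fin n → Fin 5 × Fin 5)
    {S : Finset (Fin n × Fin n)} (hS : IsMixed a b S) :
    (-1 : ℂ) ^ crossNum (swapPairs a b S) * DScalar (I ∘ Equiv.swap a b) (swapPairs a b S)
      = - ((-1 : ℂ) ^ crossNum S * DScalar I S) := by
  obtain ⟨⟨hlt, hdisj⟩, hmem, hcov⟩ := hS
  rw [neg_one_pow_crossNum_swapPairs, DScalar_swapPairs_mul]
  set X := ∏ z ∈ S ×ˢ S, crossFactor (z.1.map (Equiv.swap a b) (Equiv.swap a b))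
    (z.2.map (Equiv.swap a b) (Equiv.swap a b)) * crossFactor z.1 z.2 with hX
  set Y := ∏ q ∈ S, (-1 : ℂ) ^ (q.1.val + q.2.val + (Equiv.swap a b q.1).val
    + (Equiv.swap a b q.2).val) with hY
  suffices h : X * Y = -1 by
    linear_combination ((-1 : ℂ) ^ crossNum S * DScalar I S) * h
  have hne : ∀ q ∈ S, q ≠ (a, b) := fun q hq h => hmem (h ▸ hq)
  have hle : ∀ c : Fin n, ∀ q ∈ S, ∀ q' ∈ S, (c = q.1 ∨ c = q.2) → (c = q'.1 ∨ c = q'.2) →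
      q = q' := by
    intro c q hq q' hq' h h'
    by_contra hqq
    have := hdisj q hq q' hq' hqq
    grind
  have hnot : ∀ q ∈ S, (a = q.1 ∨ a = q.2) → (b = q.1 ∨ b = q.2) → False := by
    intro q hq h h'
    have h1 := hlt q hq
    have h2 := hne q hq
    obtain ⟨x, y⟩ := q
    simp only [ne_eq, Prod.mk.injEq, Fin.lt_def, Fin.ext_iff] at *
    omega
  by_cases hA : ∃ q ∈ S, a = q.1 ∨ a = q.2
  · obtain ⟨q, hq, haq⟩ := hA
    by_cases hB : ∃ q ∈ S, b = q.1 ∨ b = q.2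
    · obtain ⟨q', hq', hbq⟩ := hB
      have hqq : q ≠ q' := by
        rintro rfl
        exact hnot q hq haq hbq
      have h1 : Y = -1 * -1 := by
        rw [hY, Finset.prod_eq_mul q q' hqq, parityFactor_of_mem hab (hlt q hq) (hne q hq)
          (Or.inl haq), parityFactor_of_mem hab (hlt q' hq') (hne q' hq') (Or.inr hbq)]
        · rintro r hr ⟨hrq, hrq'⟩
          apply parityFactor_of_not_mem
          · rw [← not_or]
            exact fun h => hrq (hle a r hr q hq h haq)
          · rw [← not_or]
            exact fun h => hrq' (hle b r hr q' hq' h hbq)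
        · exact fun h => absurd hq h
        · exact fun h => absurd hq' h
      have h2 : X = -1 := by
        rw [hX, Finset.prod_eq_mul (q, q') (q', q) (by simp [hqq])]
        · exact crossFactor_swap_of_mem hab (hlt q hq) (hlt q' hq') (hdisj q hq q' hq' hqq)
            haq hbq
        · rintro ⟨r, r'⟩ hr ⟨hr1, hr2⟩
          rw [Finset.mem_product] at hr
          apply crossFactor_swap_of_not_mem hab
          · rintro ⟨h, h'⟩
            exact hr1 (Prod.ext (hle a _ hr.1 q hq h haq) (hle b _ hr.2 q' hq' h' hbq))
          · rintro ⟨h, h'⟩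
            exact hr2 (Prod.ext (hle b _ hr.1 q' hq' h' hbq) (hle a _ hr.2 q hq h haq))
        · exact fun h => absurd (Finset.mk_mem_product hq hq') h
        · exact fun h => absurd (Finset.mk_mem_product hq' hq) h
      rw [h1, h2]; norm_num
    · push Not at hB
      have h1 : Y = -1 := by
        rw [hY, Finset.prod_eq_single_of_mem q hq,
          parityFactor_of_mem hab (hlt q hq) (hne q hq) (Or.inl haq)]
        intro r hr hrq
        apply parityFactor_of_not_mem _ (hB r hr)
        rw [← not_or]
        exact fun h => hrq (hle a r hr q hq h haq)
      have h2 : X = 1 := by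
        refine Finset.prod_eq_one fun z hz => ?_
        rw [Finset.mem_product] at hz
        have := hB _ hz.1
        have := hB _ hz.2
        apply crossFactor_swap_of_not_mem hab <;> tauto
      rw [h1, h2]; norm_num
  · by_cases hB : ∃ q ∈ S, b = q.1 ∨ b = q.2
    · obtain ⟨q, hq, hbq⟩ := hB
      push Not at hA
      have h1 : Y = -1 := by
        rw [hY, Finset.prod_eq_single_of_mem q hq,
          parityFactor_of_mem hab (hlt q hq) (hne q hq) (Or.inr hbq)]
        intro r hr hrq
        apply parityFactor_of_not_mem (hA r hr)
        rw [← not_or]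
        exact fun h => hrq (hle b r hr q hq h hbq)
      have h2 : X = 1 := by
        refine Finset.prod_eq_one fun z hz => ?_
        rw [Finset.mem_product] at hz
        have := hA _ hz.1
        have := hA _ hz.2
        apply crossFactor_swap_of_not_mem hab <;> tauto
      rw [h1, h2]; norm_num
    · push Not at hA hB
      exact absurd ⟨mem_uncovered.2 hA, mem_uncovered.2 hB⟩ hcov

theorem omegaBody_swapPairs {A : Type*} [Ring A] [Algebra ℂ A] (hab : b.val = a.val + 1)
    (dd : Fin 5 → Fin 5 → A) (pp : Fin 5 → A) (I : Fin n → Fin 5 × Fin 5)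
    {S : Finset (Fin n × Fin n)} (hS : IsMixed a b S) :
    omegaBody dd pp (I ∘ Equiv.swap a b) (swapPairs a b S) = - omegaBody dd pp I S := by
  unfold omegaBody
  rw [sign_swapPairs hab I hS, dRest_swapPairs hab dd I hS, pCount_swapPairs, neg_smul]

theorem sum_omegaBody_isMixed {A : Type*} [Ring A] [Algebra ℂ A] (hab : b.val = a.val + 1)
    (dd : Fin 5 → Fin 5 → A) (pp : Fin 5 → A) (I : Fin n → Fin 5 × Fin 5) :
    ∑ S with IsMixed a b S, omegaBody dd pp (I ∘ Equiv.swap a b) S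
      = - ∑ S with IsMixed a b S, omegaBody dd pp I S := by
  rw [← Finset.sum_neg_distrib]
  symm
  refine Finset.sum_nbij' (swapPairs a b) (swapPairs a b) ?_ ?_ ?_ ?_ ?_
  · simpa using fun S hS => IsMixed.swapPairs hab hS
  · simpa using fun S hS => IsMixed.swapPairs hab hS
  · exact fun S _ => swapPairs_swapPairs S
  · exact fun S _ => swapPairs_swapPairs S
  · intro S hS
    exact (omegaBody_swapPairs hab dd pp I (by simpa using hS)).symm

theorem sort_eq_of_pairwise_lt {U : Finset (Fin n)} {l : List (Fin n)}
    (hl : l.Pairwise (· < ·)) (hU : ∀ x, x ∈ l ↔ x ∈ U) : U.sort (· ≤ ·) = l := by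
  have hnd : l.Nodup := hl.imp (fun h => h.ne)
  have h : l.toFinset = U := by
    ext x
    rw [List.mem_toFinset, hU]
  rw [← h]
  exact (List.toFinset_sort (· ≤ ·) hnd).2 (hl.imp (fun h => h.le))

theorem pairwise_sort_append {U : Finset (Fin n)} (hab : a < b) {m : List (Fin n)}
    (hm : m.Pairwise (· < ·)) (hm' : ∀ x ∈ m, a ≤ x ∧ x ≤ b) :
    ((U.filter (· < a)).sort (· ≤ ·) ++ (m ++ (U.filter (b < ·)).sort (· ≤ ·))).Pairwise
      (· < ·) := by
  rw [List.pairwise_append, List.pairwise_append]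
  refine ⟨(Finset.sortedLT_sort _).pairwise, ⟨hm, (Finset.sortedLT_sort _).pairwise, ?_⟩, ?_⟩
  · intro x hx y hy
    simp only [Finset.mem_sort, Finset.mem_filter] at hy
    exact (hm' x hx).2.trans_lt hy.2
  · intro x hx y hy
    simp only [Finset.mem_sort, Finset.mem_filter] at hx
    simp only [List.mem_append, Finset.mem_sort, Finset.mem_filter] at hy
    rcases hy with hy | hy
    · exact hx.2.trans_le (hm' y hy).1
    · exact hx.2.trans (hab.trans hy.2)

theorem sort_eq_append_of_mem (hab : b.val = a.val + 1) {U : Finset (Fin n)} (ha : a ∈ U)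
    (hb : b ∈ U) : U.sort (· ≤ ·) =
      (U.filter (· < a)).sort (· ≤ ·) ++ ([a, b] ++ (U.filter (b < ·)).sort (· ≤ ·)) := by
  have hlt : a < b := by rw [Fin.lt_def]; omega
  refine sort_eq_of_pairwise_lt (pairwise_sort_append hlt (by simpa using hlt) ?_) ?_
  · simp [hlt.le]
  · intro x
    simp only [List.mem_append, Finset.mem_sort, Finset.mem_filter, List.mem_cons,
      List.not_mem_nil, or_false]
    constructor
    · rintro (h | (rfl | rfl) | h)
      exacts [h.1, ha, hb, h.1]
    · intro hx
      simp only [hx, true_and, Fin.ext_iff, Fin.lt_def]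
      omega

theorem uncovered_insert (S : Finset (Fin n × Fin n)) (i : Fin n) :
    i ∈ uncovered (insert (a, b) S) ↔ i ∈ uncovered S ∧ i ≠ a ∧ i ≠ b := by
  simp only [mem_uncovered, Finset.forall_mem_insert]
  tauto

theorem sort_uncovered_insert (hab : b.val = a.val + 1) (S : Finset (Fin n × Fin n)) :
    (uncovered (insert (a, b) S)).sort (· ≤ ·) =
      ((uncovered S).filter (· < a)).sort (· ≤ ·) ++
        ((uncovered S).filter (b < ·)).sort (· ≤ ·) := by
  have hlt : a < b := by rw [Fin.lt_def]; omega
  refine sort_eq_of_pairwise_lt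
    (pairwise_sort_append (m := []) hlt List.Pairwise.nil (by simp)) ?_
  intro x
  rw [uncovered_insert]
  simp only [List.mem_append, Finset.mem_sort, Finset.mem_filter, ← and_or_left, Fin.ext_iff,
    Fin.lt_def, ne_eq]
  refine and_congr_right fun _ => ?_
  omega

theorem crossNum_insert (hab : b.val = a.val + 1) {S : Finset (Fin n × Fin n)}
    (ha : a ∈ uncovered S) (hb : b ∈ uncovered S) :
    crossNum (insert (a, b) S) = crossNum S := by
  unfold crossNum
  congr 1
  ext ⟨q, q'⟩
  rw [mem_uncovered] at ha hb
  rw [Finset.mem_filter, Finset.mem_filter, Finset.mem_product, Finset.mem_product]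
  constructor
  · rintro ⟨⟨h1, h2⟩, h3, h4⟩
    refine ⟨⟨?_, ?_⟩, h3, h4⟩
    · refine (Finset.mem_insert.1 h1).resolve_left ?_
      intro hq
      obtain ⟨x, y⟩ := q
      obtain ⟨z, w⟩ := q'
      rw [Prod.mk.injEq] at hq
      obtain ⟨rfl, rfl⟩ := hq
      simp only [crosses, Fin.lt_def] at h3 h4
      omega
    · refine (Finset.mem_insert.1 h2).resolve_left ?_
      intro hq
      rcases Finset.mem_insert.1 h1 with h5 | h5
      · simp only at h3 hq h5
        rw [hq, h5] at h3
        exact lt_irrefl _ h3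
      have h6 := ha _ h5
      have h7 := hb _ h5
      obtain ⟨x, y⟩ := q
      obtain ⟨z, w⟩ := q'
      rw [Prod.mk.injEq] at hq
      obtain ⟨rfl, rfl⟩ := hq
      simp only [crosses, Fin.lt_def, ne_eq, Fin.ext_iff] at h3 h4 h6 h7
      omega
  · rintro ⟨⟨h1, h2⟩, h3⟩
    exact ⟨⟨Finset.mem_insert_of_mem h1, Finset.mem_insert_of_mem h2⟩, h3⟩

theorem notMem_of_mem_uncovered {S : Finset (Fin n × Fin n)} (ha : a ∈ uncovered S) :
    (a, b) ∉ S := fun h => (mem_uncovered.1 ha _ h).1 rfl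

theorem DScalar_insert (hab : b.val = a.val + 1) (I : Fin n → Fin 5 × Fin 5)
    {S : Finset (Fin n × Fin n)} (ha : a ∈ uncovered S) :
    DScalar I (insert (a, b) S) =
      - ((eps (I a).1 (I a).2 (I b).1 (I b).2 : ℂ) / 2) * DScalar I S := by
  rw [DScalar, Finset.prod_insert (notMem_of_mem_uncovered ha), DScalar]
  have : (-1 : ℂ) ^ (a.val + b.val) = -1 := Odd.neg_one_pow ⟨a.val, by omega⟩
  simp only [this]
  ring

theorem pCount_insert (I : Fin n → Fin 5 × Fin 5) {S : Finset (Fin n × Fin n)}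
    (ha : a ∈ uncovered S) (t : Fin 5) : pCount I (insert (a, b) S) t =
      pCount I S t + if tIdx (I a).1 (I a).2 (I b).1 (I b).2 = t then 1 else 0 := by
  rw [pCount, Finset.filter_insert, pCount]
  split_ifs with h
  · rw [Finset.card_insert_of_notMem
      (fun h' => notMem_of_mem_uncovered ha (Finset.mem_filter.1 h').1)]
  · rfl

theorem pMono_add_single {A : Type*} [Ring A] {pp : Fin 5 → A}
    (hp : ∀ s t, pp s * pp t = pp t * pp s) (c : Fin 5 → ℕ) (u : Fin 5) :
    pMono pp (fun t => c t + if u = t then 1 else 0) = pp u * pMono pp c := by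
  have h : ∀ s t k, pp s ^ k * pp t = pp t * pp s ^ k := fun s t k =>
    (Commute.pow_left (hp s t) k).eq
  unfold pMono
  fin_cases u <;> simp [pow_succ, h, mul_assoc] <;> simp [← mul_assoc, h]

theorem isSIF_insert (hab : b.val = a.val + 1) {S : Finset (Fin n × Fin n)}
    (hS : isSIF S) (ha : a ∈ uncovered S) (hb : b ∈ uncovered S) :
    isSIF (insert (a, b) S) := by
  rw [mem_uncovered] at ha hb
  refine ⟨fun q hq => ?_, fun q hq q' hq' hne => ?_⟩
  · rcases Finset.mem_insert.1 hq with rfl | hq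
    · rw [Fin.lt_def]; simp only; omega
    · exact hS.1 q hq
  · rcases Finset.mem_insert.1 hq with rfl | hq <;> rcases Finset.mem_insert.1 hq' with rfl | hq'
    · exact absurd rfl hne
    · exact ⟨(ha _ hq').1, (ha _ hq').2, (hb _ hq').1, (hb _ hq').2⟩
    · exact ⟨(ha _ hq).1.symm, (hb _ hq).1.symm, (ha _ hq).2.symm, (hb _ hq).2.symm⟩
    · exact hS.2 q hq q' hq' hne

theorem isSIF.erase {S : Finset (Fin n × Fin n)} (hS : isSIF S) (q : Fin n × Fin n) :
    isSIF (S.erase q) :=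
  ⟨fun r hr => hS.1 r (Finset.mem_of_mem_erase hr), fun r hr r' hr' =>
    hS.2 r (Finset.mem_of_mem_erase hr) r' (Finset.mem_of_mem_erase hr')⟩

theorem isSIF.mem_uncovered_erase {S : Finset (Fin n × Fin n)} (hS : isSIF S)
    (h : (a, b) ∈ S) : a ∈ uncovered (S.erase (a, b)) ∧ b ∈ uncovered (S.erase (a, b)) := by
  simp only [mem_uncovered]
  refine ⟨fun q hq => ?_, fun q hq => ?_⟩ <;>
  · have h1 := hS.2 _ h q (Finset.mem_of_mem_erase hq) (Finset.ne_of_mem_erase hq).symm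
    tauto

theorem swap_apply_of_mem_uncovered {S : Finset (Fin n × Fin n)} (ha : a ∈ uncovered S)
    (hb : b ∈ uncovered S) {q : Fin n × Fin n} (hq : q ∈ S) :
    Equiv.swap a b q.1 = q.1 ∧ Equiv.swap a b q.2 = q.2 := by
  have h1 := mem_uncovered.1 ha q hq
  have h2 := mem_uncovered.1 hb q hq
  exact ⟨Equiv.swap_apply_of_ne_of_ne h1.1.symm h2.1.symm,
    Equiv.swap_apply_of_ne_of_ne h1.2.symm h2.2.symm⟩

theorem DScalar_comp_swap (I : Fin n → Fin 5 × Fin 5) {S : Finset (Fin n × Fin n)}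
    (ha : a ∈ uncovered S) (hb : b ∈ uncovered S) :
    DScalar (I ∘ Equiv.swap a b) S = DScalar I S := by
  refine Finset.prod_congr rfl fun q hq => ?_
  obtain ⟨h1, h2⟩ := swap_apply_of_mem_uncovered ha hb hq
  simp only [Function.comp, h1, h2]

theorem pCount_comp_swap (I : Fin n → Fin 5 × Fin 5) {S : Finset (Fin n × Fin n)}
    (ha : a ∈ uncovered S) (hb : b ∈ uncovered S) :
    pCount (I ∘ Equiv.swap a b) S = pCount I S := by
  funext t
  unfold pCount
  congr 1
  refine Finset.filter_congr fun q hq => ?_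
  obtain ⟨h1, h2⟩ := swap_apply_of_mem_uncovered ha hb hq
  simp only [Function.comp, h1, h2]

variable {A : Type*} [Ring A] [Algebra ℂ A]

theorem E510Rep.commute_list_prod (R : E510Rep A) (t : Fin 5) (I : Fin n → Fin 5 × Fin 5)
    (l : List (Fin n)) : Commute (R.p t) (l.map fun i => R.d (I i).1 (I i).2).prod := by
  apply Commute.list_prod_right
  intro x hx
  obtain ⟨i, _, rfl⟩ := List.mem_map.1 hx
  exact R.pd_comm t _ _

theorem E510Rep.commute_pMono (R : E510Rep A) (t : Fin 5) (c : Fin 5 → ℕ) :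
    Commute (R.p t) (pMono R.p c) := by
  have h : ∀ s k, Commute (R.p t) (R.p s ^ k) := fun s k =>
    Commute.pow_right (R.pp_comm t s) k
  exact ((((h 0 _).mul_right (h 1 _)).mul_right (h 2 _)).mul_right (h 3 _)).mul_right (h 4 _)

theorem omegaBody_insert (R : E510Rep A) (hab : b.val = a.val + 1)
    (I : Fin n → Fin 5 × Fin 5) {S : Finset (Fin n × Fin n)} (ha : a ∈ uncovered S)
    (hb : b ∈ uncovered S) :
    omegaBody R.d R.p (I ∘ Equiv.swap a b) S + omegaBody R.d R.p I S =
      - (omegaBody R.d R.p (I ∘ Equiv.swap a b) (insert (a, b) S) +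
        omegaBody R.d R.p I (insert (a, b) S)) := by
  have hcount : ∀ J : Fin n → Fin 5 × Fin 5, pMono R.p (pCount J (insert (a, b) S)) =
      R.p (tIdx (J a).1 (J a).2 (J b).1 (J b).2) * pMono R.p (pCount J S) := by
    intro J
    rw [← pMono_add_single R.pp_comm]
    congr 1
    funext t
    exact pCount_insert J ha t
  have hrest : ∀ J : Fin n → Fin 5 × Fin 5, dRest R.d J S =
      (((((uncovered S).filter (· < a)).sort (· ≤ ·)).map
        fun i => R.d (J i).1 (J i).2).prod * (R.d (J a).1 (J a).2 * R.d (J b).1 (J b).2)) *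
      ((((uncovered S).filter (b < ·)).sort (· ≤ ·)).map
        fun i => R.d (J i).1 (J i).2).prod := by
    intro J
    change (((uncovered S).sort (· ≤ ·)).map _).prod = _
    rw [sort_eq_append_of_mem hab ha hb]
    simp only [List.map_append, List.prod_append, List.map_cons, List.map_nil, List.prod_cons,
      List.prod_nil, mul_one, mul_assoc]
  have hrest' : ∀ J : Fin n → Fin 5 × Fin 5, dRest R.d J (insert (a, b) S) =
      ((((uncovered S).filter (· < a)).sort (· ≤ ·)).map
        fun i => R.d (J i).1 (J i).2).prod *
      ((((uncovered S).filter (b < ·)).sort (· ≤ ·)).map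
        fun i => R.d (J i).1 (J i).2).prod := by
    intro J
    change (((uncovered (insert (a, b) S)).sort (· ≤ ·)).map _).prod = _
    rw [sort_uncovered_insert hab, List.map_append, List.prod_append]
  have hlow : ((((uncovered S).filter (· < a)).sort (· ≤ ·)).map
        fun i => R.d ((I ∘ Equiv.swap a b) i).1 ((I ∘ Equiv.swap a b) i).2) =
      ((((uncovered S).filter (· < a)).sort (· ≤ ·)).map fun i => R.d (I i).1 (I i).2) := by
    refine List.map_congr_left fun i hi => ?_
    simp only [Finset.mem_sort, Finset.mem_filter, Fin.lt_def] at hi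
    rw [Function.comp_apply, Equiv.swap_apply_of_ne_of_ne] <;> rw [ne_eq, Fin.ext_iff] <;> omega
  have hhigh : ((((uncovered S).filter (b < ·)).sort (· ≤ ·)).map
        fun i => R.d ((I ∘ Equiv.swap a b) i).1 ((I ∘ Equiv.swap a b) i).2) =
      ((((uncovered S).filter (b < ·)).sort (· ≤ ·)).map fun i => R.d (I i).1 (I i).2) := by
    refine List.map_congr_left fun i hi => ?_
    simp only [Finset.mem_sort, Finset.mem_filter, Fin.lt_def] at hi
    rw [Function.comp_apply, Equiv.swap_apply_of_ne_of_ne] <;> rw [ne_eq, Fin.ext_iff] <;> omega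
  unfold omegaBody
  rw [hcount, hcount, hrest, hrest, hrest', hrest', hlow, hhigh, crossNum_insert hab ha hb,
    DScalar_insert hab _ ha, DScalar_insert hab _ ha, DScalar_comp_swap I ha hb,
    pCount_comp_swap I ha hb]
  have hX := fun t => R.commute_list_prod t I (((uncovered S).filter (· < a)).sort (· ≤ ·))
  have hP := fun t => R.commute_pMono t (pCount I S)
  have hdd := R.dd_rel (I a).1 (I a).2 (I b).1 (I b).2
  generalize (List.map (fun i => R.d (I i).1 (I i).2)
    (((uncovered S).filter (· < a)).sort (· ≤ ·))).prod = X at *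
  generalize (List.map (fun i => R.d (I i).1 (I i).2)
    (((uncovered S).filter (b < ·)).sort (· ≤ ·))).prod = Y at *
  generalize pMono R.p (pCount I S) = P at *
  simp only [Function.comp_apply, Equiv.swap_apply_left, Equiv.swap_apply_right]
  rw [eps_swap (I a).1 (I a).2 (I b).1 (I b).2, tIdx_swap (I a).1 (I a).2 (I b).1 (I b).2]
  generalize tIdx (I a).1 (I a).2 (I b).1 (I b).2 = t at *
  generalize eps (I a).1 (I a).2 (I b).1 (I b).2 = e at *
  have h1 : P * (X * (R.d (I b).1 (I b).2 * R.d (I a).1 (I a).2) * Y) +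
      P * (X * (R.d (I a).1 (I a).2 * R.d (I b).1 (I b).2) * Y) =
      (e : ℂ) • (R.p t * P * (X * Y)) := by
    rw [← mul_add, ← add_mul, ← mul_add, add_comm, hdd, ← Int.cast_smul_eq_zsmul ℂ]
    simp only [mul_smul_comm, smul_mul_assoc]
    rw [← (hX t).eq, mul_assoc (R.p t) X Y, ← mul_assoc P, ← (hP t).eq]
  rw [← smul_add, h1, smul_smul, ← add_smul, ← neg_smul]
  congr 1
  ring

theorem omegaOf_eq_sum (dd : Fin 5 → Fin 5 → A) (pp : Fin 5 → A) (I : Fin n → Fin 5 × Fin 5) :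
    omegaOf dd pp I = ∑ S with isSIF S, omegaBody dd pp I S := by
  rw [Finset.sum_filter, omegaOf]

theorem omegaOf_eq_add (hab : b.val = a.val + 1) (dd : Fin 5 → Fin 5 → A) (pp : Fin 5 → A)
    (I : Fin n → Fin 5 × Fin 5) :
    omegaOf dd pp I = ∑ S with IsMixed a b S, omegaBody dd pp I S +
      ∑ S with isSIF S ∧ a ∈ uncovered S ∧ b ∈ uncovered S,
        (omegaBody dd pp I S + omegaBody dd pp I (insert (a, b) S)) := by
  have h : ∑ S with isSIF S ∧ a ∈ uncovered S ∧ b ∈ uncovered S,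
      omegaBody dd pp I (insert (a, b) S) = ∑ S with isSIF S ∧ (a, b) ∈ S, omegaBody dd pp I S := by
    refine Finset.sum_nbij' (insert (a, b)) (fun S => S.erase (a, b)) ?_ ?_ ?_ ?_ ?_
    · intro S hS
      simp only [Finset.mem_filter, Finset.mem_univ, true_and] at hS ⊢
      exact ⟨isSIF_insert hab hS.1 hS.2.1 hS.2.2, Finset.mem_insert_self _ _⟩
    · intro S hS
      simp only [Finset.mem_filter, Finset.mem_univ, true_and] at hS ⊢
      exact ⟨hS.1.erase _, hS.1.mem_uncovered_erase hS.2⟩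
    · intro S hS
      simp only [Finset.mem_filter, Finset.mem_univ, true_and] at hS
      exact Finset.erase_insert (notMem_of_mem_uncovered hS.2.1)
    · intro S hS
      simp only [Finset.mem_filter, Finset.mem_univ, true_and] at hS
      exact Finset.insert_erase hS.2
    · exact fun _ _ => rfl
  rw [Finset.sum_add_distrib, h, omegaOf_eq_sum]
  simp only [Finset.sum_filter, ← Finset.sum_add_distrib]
  refine Finset.sum_congr rfl fun S _ => ?_
  by_cases h1 : isSIF S
  · by_cases h2 : (a, b) ∈ S
    · have h3 : a ∉ uncovered S := fun h => notMem_of_mem_uncovered h h2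
      simp [IsMixed, h1, h2, h3]
    · by_cases h3 : a ∈ uncovered S ∧ b ∈ uncovered S <;> simp [IsMixed, h1, h2, h3]
  · simp [IsMixed, h1]

theorem omegaOf_comp_swap_succ (R : E510Rep A) (hab : b.val = a.val + 1)
    (I : Fin n → Fin 5 × Fin 5) :
    omegaOf R.d R.p (I ∘ Equiv.swap a b) = - omegaOf R.d R.p I := by
  rw [omegaOf_eq_add hab, omegaOf_eq_add hab, sum_omegaBody_isMixed hab, neg_add,
    ← Finset.sum_neg_distrib (f := fun S => omegaBody R.d R.p I S + _)]
  congr 1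
  refine Finset.sum_congr rfl fun S hS => ?_
  simp only [Finset.mem_filter, Finset.mem_univ, true_and] at hS
  have := omegaBody_insert R hab I hS.2.1 hS.2.2
  rw [← sub_eq_zero] at this ⊢
  rw [← this]
  abel

theorem omegaBody_comp_swap_of_mem (dd : Fin 5 → Fin 5 → A) (pp : Fin 5 → A)
    (I : Fin n → Fin 5 × Fin 5) {S : Finset (Fin n × Fin n)} (hS : isSIF S) (h : (a, b) ∈ S) :
    omegaBody dd pp (I ∘ Equiv.swap a b) S = omegaBody dd pp I S := by
  have hfix : ∀ q ∈ S, q ≠ (a, b) → Equiv.swap a b q.1 = q.1 ∧ Equiv.swap a b q.2 = q.2 := by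
    intro q hq hne
    have := hS.2 q hq _ h hne
    exact ⟨Equiv.swap_apply_of_ne_of_ne this.1 this.2.1,
      Equiv.swap_apply_of_ne_of_ne this.2.2.1 this.2.2.2⟩
  have h1 : DScalar (I ∘ Equiv.swap a b) S = DScalar I S := by
    refine Finset.prod_congr rfl fun q hq => ?_
    by_cases hne : q = (a, b)
    · subst hne
      simp only [Function.comp_apply, Equiv.swap_apply_left, Equiv.swap_apply_right]
      rw [eps_swap]
    · simp only [Function.comp_apply, hfix q hq hne]
  have h2 : pCount (I ∘ Equiv.swap a b) S = pCount I S := by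
    funext t
    unfold pCount
    congr 1
    refine Finset.filter_congr fun q hq => ?_
    by_cases hne : q = (a, b)
    · subst hne
      simp only [Function.comp_apply, Equiv.swap_apply_left, Equiv.swap_apply_right]
      rw [tIdx_swap]
    · simp only [Function.comp_apply, hfix q hq hne]
  have h3 : dRest dd (I ∘ Equiv.swap a b) S = dRest dd I S := by
    unfold dRest
    congr 1
    refine List.map_congr_left fun i hi => ?_
    simp only [Finset.mem_sort, Finset.mem_filter] at hi
    have := hi.2 _ h
    rw [Function.comp_apply, Equiv.swap_apply_of_ne_of_ne this.1 this.2]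
  unfold omegaBody
  rw [h1, h2, h3]

end Swap

section Antisymmetrization

variable {A : Type*} [Ring A] [Algebra ℂ A]

/-- `ω` is alternating under permutations of the entries of `I`. -/
theorem omegaOf_comp_perm (R : E510Rep A) {n : ℕ} (σ : Equiv.Perm (Fin n))
    (I : Fin n → Fin 5 × Fin 5) :
    omegaOf R.d R.p (I ∘ σ) = ((Equiv.Perm.sign σ : ℤ) : ℂ) • omegaOf R.d R.p I := by
  cases n with
  | zero =>
    rw [Subsingleton.elim σ 1]
    simp
  | succ n =>
    have hσ : σ ∈ Submonoid.closure
        (Set.range fun i : Fin n => Equiv.swap i.castSucc i.succ) := by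
      rw [Equiv.Perm.mclosure_swap_castSucc_succ]
      trivial
    induction hσ using Submonoid.closure_induction generalizing I with
    | mem τ hτ =>
      obtain ⟨i, rfl⟩ := hτ
      rw [omegaOf_comp_swap_succ R (by simp),
        Equiv.Perm.sign_swap (Fin.castSucc_lt_succ (i := i)).ne]
      simp
    | one => simp
    | mul σ τ _ _ hσ hτ =>
      rw [Equiv.Perm.coe_mul, ← Function.comp_assoc, hτ, hσ, smul_smul, Equiv.Perm.sign_mul]
      push_cast
      rw [mul_comm]

theorem sum_sign_omegaBody_eq_zero (dd : Fin 5 → Fin 5 → A) (pp : Fin 5 → A) {n : ℕ}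
    (I : Fin n → Fin 5 × Fin 5) {S : Finset (Fin n × Fin n)} (hS : isSIF S) (hne : S ≠ ∅) :
    ∑ σ : Equiv.Perm (Fin n), ((Equiv.Perm.sign σ : ℤ) : ℂ) • omegaBody dd pp (I ∘ σ) S = 0 := by
  obtain ⟨⟨a, b⟩, hq⟩ := Finset.nonempty_iff_ne_empty.2 hne
  have hab : a ≠ b := (hS.1 _ hq).ne
  have h : ∑ σ : Equiv.Perm (Fin n), ((Equiv.Perm.sign σ : ℤ) : ℂ) • omegaBody dd pp (I ∘ σ) S
      = - ∑ σ : Equiv.Perm (Fin n),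
        ((Equiv.Perm.sign σ : ℤ) : ℂ) • omegaBody dd pp (I ∘ σ) S := by
    rw [← Finset.sum_neg_distrib,
      ← Equiv.sum_comp (Equiv.mulRight (Equiv.swap a b))]
    refine Finset.sum_congr rfl fun σ _ => ?_
    rw [Equiv.coe_mulRight, Equiv.Perm.coe_mul, ← Function.comp_assoc,
      omegaBody_comp_swap_of_mem dd pp _ hS hq, Equiv.Perm.sign_mul,
      Equiv.Perm.sign_swap hab]
    simp
  rw [eq_neg_iff_add_eq_zero, ← two_smul ℂ] at h
  simpa using congrArg ((2 : ℂ)⁻¹ • ·) h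

theorem omegaBody_empty (dd : Fin 5 → Fin 5 → A) (pp : Fin 5 → A) {n : ℕ}
    (I : Fin n → Fin 5 × Fin 5) :
    omegaBody dd pp I ∅ = (List.ofFn fun i => dd (I i).1 (I i).2).prod := by
  simp [omegaBody, crossNum, DScalar, pCount, pMono, dRest, Fin.sort_univ, List.ofFn_eq_map]

theorem isSIF_empty {n : ℕ} : isSIF (∅ : Finset (Fin n × Fin n)) := by
  simp [isSIF]

end Antisymmetrization

/-- Corollary: `ω_I = (1/d!) ∑_{σ ∈ S_d} sgn(σ) d_{I_{σ(1)}} ⋯ d_{I_{σ(d)}}`. -/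
theorem omega_eq_antisymmetrization {A : Type*} [Ring A] [Algebra ℂ A] (R : E510Rep A)
    (d : ℕ) (I : Fin d → Fin 5 × Fin 5) :
    omegaOf R.d R.p I
      = ((1 : ℂ) / (d.factorial : ℂ)) •
          ∑ σ : Equiv.Perm (Fin d), ((Equiv.Perm.sign σ : ℤ) : ℂ) •
            (List.ofFn (fun a => R.d (I (σ a)).1 (I (σ a)).2)).prod := by
  have hfac : (d.factorial : ℂ) ≠ 0 := by exact_mod_cast d.factorial_ne_zero
  have h1 : ∑ σ : Equiv.Perm (Fin d), ((Equiv.Perm.sign σ : ℤ) : ℂ) • omegaOf R.d R.p (I ∘ σ)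
      = (d.factorial : ℂ) • omegaOf R.d R.p I := by
    have : ∀ σ : Equiv.Perm (Fin d),
        ((Equiv.Perm.sign σ : ℤ) : ℂ) • omegaOf R.d R.p (I ∘ σ) = omegaOf R.d R.p I := by
      intro σ
      rw [omegaOf_comp_perm, smul_smul, ← Int.cast_mul, Int.units_coe_mul_self, Int.cast_one,
        one_smul]
    simp only [this, Finset.sum_const, Finset.card_univ, Fintype.card_perm, Fintype.card_fin]
    rw [Nat.cast_smul_eq_nsmul]
  have h2 : ∑ σ : Equiv.Perm (Fin d), ((Equiv.Perm.sign σ : ℤ) : ℂ) • omegaOf R.d R.p (I ∘ σ)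
      = ∑ σ : Equiv.Perm (Fin d), ((Equiv.Perm.sign σ : ℤ) : ℂ) •
          (List.ofFn (fun a => R.d (I (σ a)).1 (I (σ a)).2)).prod := by
    simp only [omegaOf_eq_sum, Finset.smul_sum]
    rw [Finset.sum_comm, Finset.sum_eq_single_of_mem ∅ (by simp [isSIF_empty])]
    · simp only [omegaBody_empty, Function.comp_apply]
    · intro S hS hne
      exact sum_sign_omegaBody_eq_zero R.d R.p I (Finset.mem_filter.1 hS).2 hne
  rw [← h2, h1, smul_smul, one_div, inv_mul_cancel₀ hfac, one_smul]

end
end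

section
/- For every $I=(I_1,\dots,I_d)\in\mathcal{I}_d$ and every $k$ with $2\le k\le d$ one has, in $A$, $\sum_{S\ \mathrm{SIF},\ \{1,k\}\in S}(-1)^{c(S)}D_S(I)\,d_{C_S(I)}=-\tfrac12\,(-1)^{k}\,\varepsilon_{I_1,I_k}\,\partial_{t_{I_1,I_k}}\,\omega_{(I_2,\dots,\widehat{I_k},\dots,I_d)}$, where $(I_2,\dots,\widehat{I_k},\dots,I_d)\in\mathcal{I}_{d-2}$ is the tuple obtained from $I$ by deleting the first and the $k$-th entries. -/
open scoped Classical

noncomputable section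
/-- Inserting the pair `(0, k)` into the family of pairs obtained by relabelling along `e`. -/
def insertPair {m n : ℕ} (e : Fin m ↪o Fin (n + 1)) (k : Fin (n + 1))
    (T : Finset (Fin m × Fin m)) : Finset (Fin (n + 1) × Fin (n + 1)) :=
  insert (0, k) (T.map (e.toEmbedding.prodMap e.toEmbedding))

section InsertPair

variable {m n : ℕ} {e : Fin m ↪o Fin (n + 1)} {k : Fin (n + 1)}

theorem zero_pair_notMem_map (h0 : ∀ a, 0 < e a) (T : Finset (Fin m × Fin m)) :
    ((0 : Fin (n + 1)), k) ∉ T.map (e.toEmbedding.prodMap e.toEmbedding) := by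
  simp only [Finset.mem_map, not_exists, not_and]
  rintro ⟨a, b⟩ - h
  exact (h0 a).ne' (congrArg Prod.fst h)

theorem mem_insertPair {T : Finset (Fin m × Fin m)} {q : Fin (n + 1) × Fin (n + 1)} :
    q ∈ insertPair e k T ↔ q = (0, k) ∨ ∃ a b, (a, b) ∈ T ∧ (e a, e b) = q := by
  simp [insertPair]

theorem isSIF_insertPair (h0 : ∀ a, 0 < e a) (hek : ∀ a, e a ≠ k) (hk : 0 < k)
    {T : Finset (Fin m × Fin m)} : isSIF (insertPair e k T) ↔ isSIF T := by
  constructor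
  · rintro ⟨h1, h2⟩
    refine ⟨fun q hq => ?_, fun q hq q' hq' hne => ?_⟩
    · exact e.lt_iff_lt.1 (h1 (e q.1, e q.2) (mem_insertPair.2 (.inr ⟨q.1, q.2, hq, rfl⟩)))
    · have := h2 (e q.1, e q.2) (mem_insertPair.2 (.inr ⟨q.1, q.2, hq, rfl⟩))
        (e q'.1, e q'.2) (mem_insertPair.2 (.inr ⟨q'.1, q'.2, hq', rfl⟩))
        (fun h => hne (Prod.ext (e.injective (congrArg Prod.fst h))
          (e.injective (congrArg Prod.snd h))))
      simpa using this
  · rintro ⟨h1, h2⟩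
    refine ⟨fun q hq => ?_, fun q hq q' hq' hne => ?_⟩
    · rcases mem_insertPair.1 hq with rfl | ⟨a, b, hab, rfl⟩
      · exact hk
      · exact e.lt_iff_lt.2 (h1 _ hab)
    · rcases mem_insertPair.1 hq with rfl | ⟨a, b, hab, rfl⟩ <;>
        rcases mem_insertPair.1 hq' with rfl | ⟨a', b', hab', rfl⟩
      · exact absurd rfl hne
      · exact ⟨(h0 _).ne, (h0 _).ne, (hek _).symm, (hek _).symm⟩
      · exact ⟨(h0 _).ne', hek _, (h0 _).ne', hek _⟩
      · have := h2 _ hab _ hab' (by rintro h; cases h; exact hne rfl)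
        simpa using this

theorem crossNum_eq_sum {n : ℕ} (S : Finset (Fin n × Fin n)) :
    crossNum S = ∑ q ∈ S, ∑ q' ∈ S, if q.1 < q'.1 ∧ crosses q q' then 1 else 0 := by
  rw [crossNum, Finset.card_filter, Finset.sum_product]

theorem crossNum_insertPair (h0 : ∀ a, 0 < e a) (T : Finset (Fin m × Fin m)) :
    crossNum (insertPair e k T) =
      crossNum T + ∑ q ∈ T, if e q.1 < k ∧ k < e q.2 then 1 else 0 := by
  have hp := zero_pair_notMem_map (k := k) h0 T
  simp only [crossNum_eq_sum, insertPair, Finset.sum_insert hp, Finset.sum_map]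
  have h1 : ∀ a, ¬ e a < 0 := fun a => (h0 a).not_gt
  have h2 : ∀ q : Fin m × Fin m, crosses (0, k) (e q.1, e q.2) ↔ e q.1 < k ∧ k < e q.2 := fun q => by
    simp [crosses, h0]
  have h3 : ∀ q q' : Fin m × Fin m, crosses (e q.1, e q.2) (e q'.1, e q'.2) ↔ crosses q q' := fun q q' => by
    simp [crosses]
  simp only [Function.Embedding.prodMap, Function.Embedding.coeFn_mk, Prod.map,
    RelEmbedding.coe_toEmbedding, OrderEmbedding.lt_iff_lt, h0, h1, h2, h3, lt_irrefl,
    true_and, false_and, if_false, zero_add]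
  rw [add_comm]

theorem DScalar_insertPair (h0 : ∀ a, 0 < e a)
    (hval : ∀ a, (e a : ℕ) = if e a < k then (a : ℕ) + 1 else a + 2)
    (I : Fin (n + 1) → Fin 5 × Fin 5) {T : Finset (Fin m × Fin m)} (hT : isSIF T)
    (hek : ∀ a, e a ≠ k) :
    (-1 : ℂ) ^ crossNum (insertPair e k T) * DScalar I (insertPair e k T) =
      (-(1 : ℂ) / 2 * (-1 : ℂ) ^ ((k : ℕ) + 1) *
        ((eps (I 0).1 (I 0).2 (I k).1 (I k).2 : ℤ) : ℂ)) *
      ((-1 : ℂ) ^ crossNum T * DScalar (I ∘ e) T) := by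
  have hp := zero_pair_notMem_map (k := k) h0 T
  have key : (∏ q ∈ T, (-1 : ℂ) ^ (if e q.1 < k ∧ k < e q.2 then 1 else 0)) *
      DScalar I (T.map (e.toEmbedding.prodMap e.toEmbedding)) = DScalar (I ∘ e) T := by
    rw [DScalar, DScalar, Finset.prod_map, ← Finset.prod_mul_distrib]
    refine Finset.prod_congr rfl fun q hq => ?_
    have hlt : e q.1 < e q.2 := e.lt_iff_lt.2 (hT.1 q hq)
    have hsign : (-1 : ℂ) ^ (if e q.1 < k ∧ k < e q.2 then 1 else 0) *
        (-1 : ℂ) ^ ((e q.1 : ℕ) + (e q.2 : ℕ)) = (-1 : ℂ) ^ ((q.1 : ℕ) + (q.2 : ℕ)) := by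
      rw [hval q.1, hval q.2]
      have h1 := hek q.1
      have h2 := hek q.2
      by_cases ha : e q.1 < k <;> by_cases hb : e q.2 < k
      · simp [ha, hb, hb.not_gt]; ring
      · have hb' : k < e q.2 := lt_of_le_of_ne (not_lt.1 hb) h2.symm
        simp [ha, hb, hb']; ring
      · exact absurd (hlt.trans hb) ha
      · simp [ha, hb]; ring
    rw [← hsign]
    simp only [Function.Embedding.prodMap, Function.Embedding.coeFn_mk, Prod.map,
      Function.comp, RelEmbedding.coe_toEmbedding]
    ring
  rw [crossNum_insertPair h0, pow_add, ← Finset.prod_pow_eq_pow_sum, ← key]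
  simp only [DScalar, insertPair]
  rw [Finset.prod_insert hp]
  simp only [Fin.val_zero, pow_succ, zero_add]
  ring

theorem pCount_insertPair (h0 : ∀ a, 0 < e a) (I : Fin (n + 1) → Fin 5 × Fin 5)
    (T : Finset (Fin m × Fin m)) :
    pCount I (insertPair e k T) =
      Pi.single (tIdx (I 0).1 (I 0).2 (I k).1 (I k).2) 1 + pCount (I ∘ e) T := by
  have hp := zero_pair_notMem_map (k := k) h0 T
  funext t
  simp only [pCount, Finset.card_filter, insertPair, Finset.sum_insert hp, Finset.sum_map,
    Pi.add_apply, Pi.single_apply, eq_comm (a := t)]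
  rfl

theorem dRest_insertPair {A : Type*} [Ring A] (h0 : ∀ a, 0 < e a) (hek : ∀ a, e a ≠ k)
    (hrange : ∀ i, i ≠ 0 → i ≠ k → ∃ a, e a = i) (dd : Fin 5 → Fin 5 → A)
    (I : Fin (n + 1) → Fin 5 × Fin 5) (T : Finset (Fin m × Fin m)) :
    dRest dd I (insertPair e k T) = dRest dd (I ∘ e) T := by
  have hset : (Finset.univ.filter fun i => ∀ q ∈ insertPair e k T, i ≠ q.1 ∧ i ≠ q.2) =
      (Finset.univ.filter fun i => ∀ q ∈ T, i ≠ q.1 ∧ i ≠ q.2).map e.toEmbedding := by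
    ext i
    simp only [Finset.mem_filter, Finset.mem_univ, true_and, Finset.mem_map,
      RelEmbedding.coe_toEmbedding]
    constructor
    · intro h
      obtain ⟨a, rfl⟩ := hrange i (h _ (mem_insertPair.2 (.inl rfl))).1
        (h _ (mem_insertPair.2 (.inl rfl))).2
      refine ⟨a, fun q hq => ?_, rfl⟩
      simpa using h _ (mem_insertPair.2 (.inr ⟨q.1, q.2, hq, rfl⟩))
    · rintro ⟨a, ha, rfl⟩ q hq
      rcases mem_insertPair.1 hq with rfl | ⟨b, c, hbc, rfl⟩
      · exact ⟨(h0 a).ne', hek a⟩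
      · simpa using ha _ hbc
  have hsort : (Finset.univ.filter fun i => ∀ q ∈ insertPair e k T,
      i ≠ q.1 ∧ i ≠ q.2).sort (· ≤ ·) =
      ((Finset.univ.filter fun i => ∀ q ∈ T, i ≠ q.1 ∧ i ≠ q.2).sort (· ≤ ·)).map e := by
    rw [hset]
    exact (Finset.map_sort e.toEmbedding _ _ _ fun a _ b _ => e.le_iff_le.symm).symm
  rw [dRest, dRest, hsort, List.map_map]
  rfl

end InsertPair

theorem pMono_single_add {A : Type*} [Ring A] {pp : Fin 5 → A}
    (hpp : ∀ s t, pp s * pp t = pp t * pp s) (t : Fin 5) (c : Fin 5 → ℕ) :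
    pMono pp (Pi.single t 1 + c) = pp t * pMono pp c := by
  have hc : ∀ s t n, pp s ^ n * pp t = pp t * pp s ^ n := fun s t n =>
    (Commute.pow_left (hpp s t) n)
  have hc' : ∀ s t n (x : A), pp s ^ n * (pp t * x) = pp t * (pp s ^ n * x) := fun s t n x => by
    rw [← mul_assoc, hc, mul_assoc]
  fin_cases t <;> simp [pMono, pow_add, mul_assoc, hc']

/-- Lemma: the part of the sum defining `ω_I` over SIF sets containing `{1,k}` equals
`-(1/2)(-1)^k ε_{I_1,I_k} ∂_{t_{I_1,I_k}} ω_{(I_2,…,Î_k,…,I_d)}` (`k` is `1`-based in the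
informal statement; here positions are `0`-based, so the pair is `{0,k}` with `k ≥ 1`). -/
theorem omega_sum_over_sif_containing_pair {A : Type*} [Ring A] [Algebra ℂ A] (R : E510Rep A)
    (m : ℕ) (I : Fin (m + 2) → Fin 5 × Fin 5) (k : Fin (m + 2)) (hk : 1 ≤ (k : ℕ)) :
    ∑ S ∈ Finset.univ.filter
        (fun S : Finset (Fin (m + 2) × Fin (m + 2)) => isSIF S ∧ ((0 : Fin (m + 2)), k) ∈ S),
      omegaBody R.d R.p I S
    = (-(1 : ℂ) / 2 * (-1 : ℂ) ^ ((k : ℕ) + 1) *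
        ((eps (I 0).1 (I 0).2 (I k).1 (I k).2 : ℤ) : ℂ)) •
        (R.p (tIdx (I 0).1 (I 0).2 (I k).1 (I k).2) *
          omegaOf R.d R.p
            (fun a : Fin m =>
              I (Fin.succ ((⟨(k : ℕ) - 1, by have := k.isLt; omega⟩ : Fin (m + 1)).succAbove a)))) := by
  have hk0 : 0 < k := Fin.lt_def.2 hk
  set j : Fin (m + 1) := ⟨(k : ℕ) - 1, by have := k.isLt; omega⟩ with hj
  have hjk : j.succ = k := Fin.ext (by simp [hj]; omega)
  let e : Fin m ↪o Fin (m + 2) := j.succAboveOrderEmb.trans (Fin.succOrderEmb (m + 1))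
  have he : ∀ a, e a = (j.succAbove a).succ := fun a => rfl
  have h0 : ∀ a, 0 < e a := fun a => Fin.succ_pos _
  have hek : ∀ a, e a ≠ k := fun a h => by
    rw [he, ← hjk, Fin.succ_inj] at h
    exact Fin.succAbove_ne j a h
  have hrange : ∀ i, i ≠ 0 → i ≠ k → ∃ a, e a = i := fun i hi hik => by
    obtain ⟨i', rfl⟩ := Fin.exists_succ_eq.2 hi
    obtain ⟨a, ha⟩ := Fin.exists_succAbove_eq (x := i') (y := j)
      (fun h => hik (by rw [h, hjk]))
    exact ⟨a, by rw [he, ha]⟩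
  have hval : ∀ a, (e a : ℕ) = if e a < k then (a : ℕ) + 1 else a + 2 := fun a => by
    simp only [he, ← hjk, Fin.succ_lt_succ_iff, Fin.val_succ]
    rcases lt_or_ge a.castSucc j with h | h
    · rw [Fin.succAbove_of_castSucc_lt _ _ h, if_pos h, Fin.val_castSucc]
    · have h' : ¬ a.succ < j := fun h' => absurd (Fin.castSucc_lt_succ.trans h') (not_lt.2 h)
      rw [Fin.succAbove_of_le_castSucc _ _ h, if_neg h', Fin.val_succ]
  rw [show (fun a : Fin m => I (Fin.succ (j.succAbove a))) = I ∘ e from rfl, omegaOf,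
    ← Finset.sum_filter, Finset.mul_sum, Finset.smul_sum]
  symm
  refine Finset.sum_bij (fun T _ => insertPair e k T) ?_ ?_ ?_ ?_
  · intro T hT
    simp only [Finset.mem_filter, Finset.mem_univ, true_and] at hT ⊢
    exact ⟨(isSIF_insertPair h0 hek hk0).2 hT, mem_insertPair.2 (.inl rfl)⟩
  · intro T _ T' _ h
    have h' := congrArg (fun S => S.erase (0, k)) h
    simp only [insertPair, Finset.erase_insert (zero_pair_notMem_map h0 _)] at h'
    exact Finset.map_injective _ h'
  · intro S hS
    simp only [Finset.mem_filter, Finset.mem_univ, true_and] at hS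
    have hins : insertPair e k (Finset.univ.filter fun q => (e q.1, e q.2) ∈ S) = S := by
      ext q
      rw [mem_insertPair]
      constructor
      · rintro (rfl | ⟨a, b, hab, rfl⟩)
        · exact hS.2
        · simpa using hab
      · intro hq
        by_cases hqk : q = (0, k)
        · exact .inl hqk
        · obtain ⟨h1, h2, h3, h4⟩ := hS.1.2 q hq _ hS.2 hqk
          obtain ⟨a, ha⟩ := hrange q.1 h1 h2
          obtain ⟨b, hb⟩ := hrange q.2 h3 h4
          exact .inr ⟨a, b, by simpa [ha, hb] using hq, by rw [ha, hb]⟩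
    refine ⟨_, ?_, hins⟩
    rw [Finset.mem_filter]
    exact ⟨Finset.mem_univ _, (isSIF_insertPair h0 hek hk0).1 (hins.symm ▸ hS.1)⟩
  · intro T hT
    rw [Finset.mem_filter] at hT
    rw [omegaBody, omegaBody, DScalar_insertPair h0 hval I hT.2 hek, pCount_insertPair h0,
      pMono_single_add R.pp_comm, dRest_insertPair h0 hek hrange, mul_smul_comm, smul_smul,
      mul_assoc (R.p _)]

end
end
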